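/- If (u,m) is a smooth solution of the MFG system, then for every t ∈ (0,T) the function t ↦ e^{−rt} ∫₀^L u_x(t,x) m(t,x) dx is differentiable and e^{rt} · d/dt ( e^{−rt} ∫₀^L u_x(t,x) m(t,x) dx ) = −(σ²/2) u_x(t,0) m_x(t,0) − (σ²/2) u_xx(t,L) m(t,L). -/

import Mathlib

open Set MeasureTheory intervalIntegral Function

noncomputable section

/-- Spatial derivative `u_x`. -/
def pdx (u : ℝ → ℝ → ℝ) (t x : ℝ) : ℝ := deriv (u t) x

/-- Second spatial derivative `u_xx`. -/
def pdxx (u : ℝ → ℝ → ℝ) (t x : ℝ) : ℝ := deriv (deriv (u t)) x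

/-- Time derivative `u_t`. -/
def pdt (u : ℝ → ℝ → ℝ) (t x : ℝ) : ℝ := deriv (fun s => u s x) t

/-- `η(t) = ∫₀^L m(t,x) dx`. -/
def mfgEta (L : ℝ) (m : ℝ → ℝ → ℝ) (t : ℝ) : ℝ := ∫ x in (0:ℝ)..L, m t x

/-- `f(t) = a(η(t)) + c(η(t)) p̄(t)`. -/
def mfgF (L ε : ℝ) (u m : ℝ → ℝ → ℝ) (t : ℝ) : ℝ :=
  2 / (2 + ε * mfgEta L m t)
    + (ε / (2 + ε * mfgEta L m t)) * ∫ x in (0:ℝ)..L, pdx u t x * m t x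

/-- `G(t,x) = (1/2)(f(t) − u_x(t,x))`. -/
def mfgG (L ε : ℝ) (u m : ℝ → ℝ → ℝ) (t x : ℝ) : ℝ :=
  (1/2) * (mfgF L ε u m t - pdx u t x)

/-- `H(t,x) = G(t,x)²`. -/
def mfgH (L ε : ℝ) (u m : ℝ → ℝ → ℝ) (t x : ℝ) : ℝ := (mfgG L ε u m t x)^2

/-- Standing assumptions on the data. -/
structure MFGData (T L σ r ε : ℝ) (uT m0 : ℝ → ℝ) : Prop where
  hT : 0 < T
  hL : 0 < L
  hσ : 0 < σ
  hr : 0 < r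
  hε : 0 ≤ ε
  uT_smooth : ContDiff ℝ 2 uT
  m0_smooth : ContDiff ℝ 2 m0
  uT_zero : uT 0 = 0
  uT_deriv_L : deriv uT L = 0
  uT_nonneg : ∀ x ∈ Icc (0:ℝ) L, 0 ≤ uT x
  uT_deriv_nonneg : ∀ x ∈ Icc (0:ℝ) L, 0 ≤ deriv uT x
  m0_zero : m0 0 = 0
  m0_L : m0 L = 0
  m0_deriv_L : deriv m0 L = 0
  m0_nonneg : ∀ x ∈ Icc (0:ℝ) L, 0 ≤ m0 x
  m0_mass : (∫ x in (0:ℝ)..L, m0 x) = 1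

/-- A smooth solution of the MFG system \eqref{main system}. -/
structure IsMFGSolution (T L σ r ε : ℝ) (uT m0 : ℝ → ℝ) (u m : ℝ → ℝ → ℝ) : Prop where
  u_smooth : ContDiff ℝ (⊤ : ℕ∞) (uncurry u)
  m_smooth : ContDiff ℝ (⊤ : ℕ∞) (uncurry m)
  hjb : ∀ t ∈ Ioo (0:ℝ) T, ∀ x ∈ Ioo (0:ℝ) L,
    pdt u t x + σ^2/2 * pdxx u t x - r * u t x + mfgH L ε u m t x = 0
  fp : ∀ t ∈ Ioo (0:ℝ) T, ∀ x ∈ Ioo (0:ℝ) L,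
    pdt m t x - σ^2/2 * pdxx m t x
      - deriv (fun y => mfgG L ε u m t y * m t y) x = 0
  m_init : ∀ x ∈ Icc (0:ℝ) L, m 0 x = m0 x
  u_term : ∀ x ∈ Icc (0:ℝ) L, u T x = uT x
  u_bdry : ∀ t ∈ Icc (0:ℝ) T, u t 0 = 0
  m_bdry : ∀ t ∈ Icc (0:ℝ) T, m t 0 = 0
  ux_bdry : ∀ t ∈ Icc (0:ℝ) T, pdx u t L = 0
  m_flux : ∀ t ∈ Icc (0:ℝ) T,
    σ^2/2 * pdx m t L + mfgG L ε u m t L * m t L = 0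

end

open scoped Topology

section SmoothSlices

variable {w : ℝ → ℝ → ℝ}

theorem hasDerivAt_pdx_fderiv (hw : ContDiff ℝ (⊤ : ℕ∞) (uncurry w)) (t x : ℝ) :
    HasDerivAt (w t) (fderiv ℝ (uncurry w) (t, x) (0, 1)) x := by
  have hf : HasFDerivAt (uncurry w) (fderiv ℝ (uncurry w) (t, x)) (t, x) :=
    (hw.differentiable (by simp) (t, x)).hasFDerivAt
  exact hf.comp_hasDerivAt x ((hasDerivAt_const x t).prodMk (hasDerivAt_id x))

theorem hasDerivAt_pdt_fderiv (hw : ContDiff ℝ (⊤ : ℕ∞) (uncurry w)) (t x : ℝ) :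
    HasDerivAt (fun s => w s x) (fderiv ℝ (uncurry w) (t, x) (1, 0)) t := by
  have hf : HasFDerivAt (uncurry w) (fderiv ℝ (uncurry w) (t, x)) (t, x) :=
    (hw.differentiable (by simp) (t, x)).hasFDerivAt
  exact hf.comp_hasDerivAt t ((hasDerivAt_id t).prodMk (hasDerivAt_const t x))

theorem uncurry_pdx_eq (hw : ContDiff ℝ (⊤ : ℕ∞) (uncurry w)) :
    uncurry (pdx w) = fun p => fderiv ℝ (uncurry w) p (0, 1) := by
  ext ⟨t, x⟩
  exact (hasDerivAt_pdx_fderiv hw t x).deriv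

theorem uncurry_pdt_eq (hw : ContDiff ℝ (⊤ : ℕ∞) (uncurry w)) :
    uncurry (pdt w) = fun p => fderiv ℝ (uncurry w) p (1, 0) := by
  ext ⟨t, x⟩
  exact (hasDerivAt_pdt_fderiv hw t x).deriv

theorem hasDerivAt_pdx (hw : ContDiff ℝ (⊤ : ℕ∞) (uncurry w)) (t x : ℝ) :
    HasDerivAt (w t) (pdx w t x) x :=
  (hasDerivAt_pdx_fderiv hw t x).differentiableAt.hasDerivAt

theorem hasDerivAt_pdt (hw : ContDiff ℝ (⊤ : ℕ∞) (uncurry w)) (t x : ℝ) :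
    HasDerivAt (fun s => w s x) (pdt w t x) t :=
  (hasDerivAt_pdt_fderiv hw t x).differentiableAt.hasDerivAt

theorem contDiff_fderiv_apply_const (hw : ContDiff ℝ (⊤ : ℕ∞) (uncurry w)) (v : ℝ × ℝ) :
    ContDiff ℝ (⊤ : ℕ∞) (fun p => fderiv ℝ (uncurry w) p v) :=
  (hw.fderiv_right (m := (⊤ : ℕ∞)) (by simp)).clm_apply contDiff_const

theorem contDiff_pdx (hw : ContDiff ℝ (⊤ : ℕ∞) (uncurry w)) :
    ContDiff ℝ (⊤ : ℕ∞) (uncurry (pdx w)) := by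
  rw [uncurry_pdx_eq hw]
  exact contDiff_fderiv_apply_const hw _

theorem contDiff_pdt (hw : ContDiff ℝ (⊤ : ℕ∞) (uncurry w)) :
    ContDiff ℝ (⊤ : ℕ∞) (uncurry (pdt w)) := by
  rw [uncurry_pdt_eq hw]
  exact contDiff_fderiv_apply_const hw _

theorem pdt_pdx_comm (hw : ContDiff ℝ (⊤ : ℕ∞) (uncurry w)) (t x : ℝ) :
    pdt (pdx w) t x = pdx (pdt w) t x := by
  have hd : DifferentiableAt ℝ (fderiv ℝ (uncurry w)) (t, x) :=
    (hw.fderiv_right (m := (⊤ : ℕ∞)) (by simp)).differentiable (by simp) (t, x)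
  have happly (v : ℝ × ℝ) : fderiv ℝ (fun p => fderiv ℝ (uncurry w) p v) (t, x)
      = (fderiv ℝ (fderiv ℝ (uncurry w)) (t, x)).flip v := by
    simpa using fderiv_clm_apply hd (differentiableAt_const v)
  have hsymm : IsSymmSndFDerivAt ℝ (uncurry w) (t, x) :=
    hw.contDiffAt.isSymmSndFDerivAt
      (minSmoothness_of_isRCLikeNormedField.trans_le (WithTop.coe_le_coe.2 le_top))
  have h1 : pdt (pdx w) t x = fderiv ℝ (uncurry (pdx w)) (t, x) (1, 0) :=
    (hasDerivAt_pdt_fderiv (contDiff_pdx hw) t x).deriv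
  have h2 : pdx (pdt w) t x = fderiv ℝ (uncurry (pdt w)) (t, x) (0, 1) :=
    (hasDerivAt_pdx_fderiv (contDiff_pdt hw) t x).deriv
  rw [h1, h2, uncurry_pdx_eq hw, uncurry_pdt_eq hw, happly, happly]
  exact hsymm _ _

theorem hasDerivAt_integral_pdt (hw : ContDiff ℝ (⊤ : ℕ∞) (uncurry w)) (a b t : ℝ) :
    HasDerivAt (fun s => ∫ x in a..b, w s x) (∫ x in a..b, pdt w t x) t := by
  have hc (s : ℝ) : Continuous (w s) :=
    hw.continuous.comp (Continuous.prodMk_right s)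
  have hct : Continuous (pdt w t) :=
    (contDiff_pdt hw).continuous.comp (Continuous.prodMk_right t)
  obtain ⟨C, hC⟩ := ((isCompact_closedBall t 1).prod (isCompact_uIcc (a := a) (b := b))
    ).exists_bound_of_continuousOn (contDiff_pdt hw).continuous.continuousOn
  refine (hasDerivAt_integral_of_dominated_loc_of_deriv_le (bound := fun _ => C)
    (Metric.closedBall_mem_nhds t one_pos)
    (Filter.Eventually.of_forall fun s => (hc s).aestronglyMeasurable)
    ((hc t).intervalIntegrable a b) hct.aestronglyMeasurable ?_ intervalIntegrable_const ?_).2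
  · exact Filter.Eventually.of_forall fun x hx s hs =>
      hC (s, x) ⟨hs, uIoc_subset_uIcc hx⟩
  · exact Filter.Eventually.of_forall fun x _ s _ => hasDerivAt_pdt hw s x

end SmoothSlices

section MFG

variable {T L σ r ε : ℝ} {uT m0 : ℝ → ℝ} {u m : ℝ → ℝ → ℝ}

theorem hasDerivAt_mfgG (hu : ContDiff ℝ (⊤ : ℕ∞) (uncurry u)) (t x : ℝ) :
    HasDerivAt (mfgG L ε u m t) (-(1 / 2) * pdxx u t x) x := by
  have h : HasDerivAt (pdx u t) (pdxx u t x) x := hasDerivAt_pdx (contDiff_pdx hu) t x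
  exact ((h.const_sub (mfgF L ε u m t)).const_mul (1 / 2)).congr_deriv (by ring)

/-- The spatial derivative of the Hamilton–Jacobi–Bellman equation. -/
theorem IsMFGSolution.pdt_pdx_eq (hsol : IsMFGSolution T L σ r ε uT m0 u m) {t x : ℝ}
    (ht : t ∈ Ioo (0 : ℝ) T) (hx : x ∈ Ioo (0 : ℝ) L) :
    pdt (pdx u) t x = -(σ ^ 2 / 2) * pdx (pdxx u) t x + r * pdx u t x
      + mfgG L ε u m t x * pdxx u t x := by
  have hu := hsol.u_smooth
  have hxx : HasDerivAt (pdxx u t) (pdx (pdxx u) t x) x :=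
    hasDerivAt_pdx (contDiff_pdx (contDiff_pdx hu)) t x
  have hrhs := ((hxx.const_mul (-(σ ^ 2 / 2))).add ((hasDerivAt_pdx hu t x).const_mul r)).sub
    ((hasDerivAt_mfgG (L := L) (ε := ε) (m := m) hu t x).pow 2)
  have heq : pdt u t =ᶠ[𝓝 x]
      (fun y => -(σ ^ 2 / 2) * pdxx u t y) + (fun y => r * u t y) - mfgG L ε u m t ^ 2 := by
    filter_upwards [isOpen_Ioo.mem_nhds hx] with y hy
    have h := hsol.hjb t ht y hy
    simp only [mfgH] at h
    simp only [Pi.add_apply, Pi.sub_apply, Pi.pow_apply]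
    linarith
  rw [pdt_pdx_comm hu]
  refine ((hrhs.congr_of_eventuallyEq heq).deriv).trans ?_
  push_cast
  ring

/-- The spatial flux whose divergence is `∂ₜ (u_x m) - r u_x m`. -/
noncomputable def mfgFlux (L ε σ : ℝ) (u m : ℝ → ℝ → ℝ) (t x : ℝ) : ℝ :=
  σ ^ 2 / 2 * (pdx u t x * pdx m t x - pdxx u t x * m t x)
    + pdx u t x * (mfgG L ε u m t x * m t x)

theorem hasDerivAt_mfgFlux (hu : ContDiff ℝ (⊤ : ℕ∞) (uncurry u))
    (hm : ContDiff ℝ (⊤ : ℕ∞) (uncurry m)) (t x : ℝ) :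
    HasDerivAt (mfgFlux L ε σ u m t)
      (σ ^ 2 / 2 * (pdx u t x * pdxx m t x - pdx (pdxx u) t x * m t x)
        + pdxx u t x * (mfgG L ε u m t x * m t x)
        + pdx u t x * deriv (fun y => mfgG L ε u m t y * m t y) x) x := by
  have hux : HasDerivAt (pdx u t) (pdxx u t x) x := hasDerivAt_pdx (contDiff_pdx hu) t x
  have hmx : HasDerivAt (pdx m t) (pdxx m t x) x := hasDerivAt_pdx (contDiff_pdx hm) t x
  have huxx : HasDerivAt (pdxx u t) (pdx (pdxx u) t x) x :=
    hasDerivAt_pdx (contDiff_pdx (contDiff_pdx hu)) t x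
  have hm' := hasDerivAt_pdx hm t x
  have hGm : HasDerivAt (fun y => mfgG L ε u m t y * m t y)
      (deriv (fun y => mfgG L ε u m t y * m t y) x) x :=
    ((hasDerivAt_mfgG hu t x).mul hm').differentiableAt.hasDerivAt
  exact ((((hux.mul hmx).sub (huxx.mul hm')).const_mul (σ ^ 2 / 2)).add
    (hux.mul hGm)).congr_deriv (by ring)

theorem IsMFGSolution.hasDerivAt_integral_pdx_mul
    (hsol : IsMFGSolution T L σ r ε uT m0 u m) (hL : 0 ≤ L) {t : ℝ} (ht : t ∈ Ioo (0 : ℝ) T) :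
    HasDerivAt (fun s => ∫ x in (0 : ℝ)..L, pdx u s x * m s x)
      (r * (∫ x in (0 : ℝ)..L, pdx u t x * m t x)
        + (-(σ ^ 2 / 2) * pdx u t 0 * pdx m t 0 - σ ^ 2 / 2 * pdxx u t L * m t L)) t := by
  have hu := hsol.u_smooth
  have hm := hsol.m_smooth
  have htc : t ∈ Icc (0 : ℝ) T := Ioo_subset_Icc_self ht
  have hw : ContDiff ℝ (⊤ : ℕ∞) (uncurry fun s x => pdx u s x * m s x) :=
    (contDiff_pdx hu).mul hm
  have hcont : Continuous fun x => pdx u t x * m t x :=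
    hw.continuous.comp (Continuous.prodMk_right t)
  have hcont' : Continuous (pdt (fun s x => pdx u s x * m s x) t) :=
    (contDiff_pdt hw).continuous.comp (Continuous.prodMk_right t)
  have hint := hcont.intervalIntegrable (μ := volume) 0 L
  have hint' := hcont'.intervalIntegrable (μ := volume) 0 L
  have hFTC : (∫ x in (0 : ℝ)..L, (pdt (fun s x => pdx u s x * m s x) t x
      - r * (pdx u t x * m t x))) = mfgFlux L ε σ u m t L - mfgFlux L ε σ u m t 0 := by
    refine integral_eq_sub_of_hasDerivAt_of_le hL
      (fun x _ => (hasDerivAt_mfgFlux hu hm t x).continuousAt.continuousWithinAt)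
      (fun x hx => (hasDerivAt_mfgFlux hu hm t x).congr_deriv ?_)
      (hint'.sub (hint.const_mul r))
    have hprod : pdt (fun s x => pdx u s x * m s x) t x
        = pdt (pdx u) t x * m t x + pdx u t x * pdt m t x :=
      ((hasDerivAt_pdt (contDiff_pdx hu) t x).mul (hasDerivAt_pdt hm t x)).deriv
    rw [hprod, hsol.pdt_pdx_eq ht hx]
    linear_combination (-pdx u t x) * hsol.fp t ht x hx
  rw [integral_sub hint' (hint.const_mul r), intervalIntegral.integral_const_mul] at hFTC
  refine (hasDerivAt_integral_pdt hw 0 L t).congr_deriv ?_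
  simp only [mfgFlux, hsol.ux_bdry t htc, hsol.m_bdry t htc] at hFTC
  linear_combination hFTC

end MFG

/-- the identity
e^{rt} d/dt ( e^{−rt} ∫₀^L u_x m dx ) = −(σ²/2) u_x(t,0) m_x(t,0) − (σ²/2) u_xx(t,L) m(t,L)
for t ∈ (0,T). -/
theorem mfg_nonlocal_derivative_identity (T L σ r ε : ℝ) (uT m0 : ℝ → ℝ)
    (hdata : MFGData T L σ r ε uT m0)
    (u m : ℝ → ℝ → ℝ) (hsol : IsMFGSolution T L σ r ε uT m0 u m) :
    ∀ t ∈ Ioo (0:ℝ) T,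
      HasDerivAt (fun s => Real.exp (-(r * s)) * ∫ x in (0:ℝ)..L, pdx u s x * m s x)
        (Real.exp (-(r * t)) *
          (-(σ^2/2) * pdx u t 0 * pdx m t 0 - σ^2/2 * pdxx u t L * m t L)) t := by
  intro t ht
  have hexp : HasDerivAt (fun s => Real.exp (-(r * s))) (Real.exp (-(r * t)) * -(r * 1)) t :=
    (((hasDerivAt_id t).const_mul r).neg).exp
  exact (hexp.mul (hsol.hasDerivAt_integral_pdx_mul hdata.hL.le ht)).congr_deriv (by ring)
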